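/- The derivative of the nonlinearity along the refined profile is close to its value at Q with exponential weight: there exist constants δ₀ > 0 and C > 0 such that for all real numbers α, β with |α| + |β| ≤ δ₀ and every real x, | p |Q(x) + α φ₀(x) + β φ₂(x)|^{p-1} - p Q(x)^{p-1} | ≤ C (|α| + |β|) e^{-((p-1)/2)|x|}. -/

import Mathlib

open Real

/-- The soliton `Q(x) = ((p+1)/2)^{1/(p-1)} (sech(β₀x))^{2/(p-1)}` with `β₀ = (p-1)/2`,
where `sech t = 1 / cosh t`. -/
noncomputable def solitonQ (p : ℝ) : ℝ → ℝ :=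
  fun x => ((p + 1) / 2) ^ (1 / (p - 1)) * ((Real.cosh ((p - 1) / 2 * x))⁻¹) ^ (2 / (p - 1))

/-- The nonlinearity `f(u) = |u|^{p-1} u`. -/
noncomputable def fNL (p : ℝ) : ℝ → ℝ :=
  fun u => |u| ^ (p - 1) * u

/-- The operator `(S_j* g)(x) = -g'(x) - k tanh(β₀x) g(x)` with `β₀ = (p-1)/2`,
for a constant `k`. -/
noncomputable def Sstar (p k : ℝ) (g : ℝ → ℝ) : ℝ → ℝ :=
  fun x => -(deriv g x) - k * Real.tanh ((p - 1) / 2 * x) * g x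

/-- `φ₀ = Q^{k₀}` with `k₀ = (p+1)/2`. -/
noncomputable def phi0 (p : ℝ) : ℝ → ℝ :=
  fun x => solitonQ p x ^ ((p + 1) / 2)

/-- `φ₂ = S₀*(S₁*(Q^{k₂}))` where `k₀ = (p+1)/2`, `k₁ = 1`, `k₂ = (3-p)/2`. -/
noncomputable def phi2 (p : ℝ) : ℝ → ℝ :=
  Sstar p ((p + 1) / 2) (Sstar p 1 (fun x => solitonQ p x ^ ((3 - p) / 2)))

theorem abs_rpow_sub_one_le_abs_sub_one {y q : ℝ} (hy : 0 ≤ y) (hq0 : 0 ≤ q) (hq1 : q ≤ 1) :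
    |y ^ q - 1| ≤ |y - 1| := by
  rcases le_total 1 y with h | h
  · have h1 : 1 ≤ y ^ q := Real.one_le_rpow h hq0
    have h2 : y ^ q ≤ y := Real.rpow_le_self_of_one_le h hq1
    rw [abs_of_nonneg (by linarith), abs_of_nonneg (by linarith)]
    linarith
  · have h1 : y ^ q ≤ 1 := Real.rpow_le_one hy h hq0
    have h2 : y ≤ y ^ q := Real.self_le_rpow_of_le_one hy h hq1
    rw [abs_of_nonpos (by linarith), abs_of_nonpos (by linarith)]
    linarith

/-- For `0 ≤ q ≤ 1`, the map `u ↦ |u| ^ q` is Lipschitz around `a > 0` with constant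
`a ^ (q - 1)`, without any smallness condition on the increment. -/
theorem abs_abs_add_rpow_sub_rpow_le {a h q : ℝ} (ha : 0 < a) (hq0 : 0 ≤ q) (hq1 : q ≤ 1) :
    |(|a + h|) ^ q - a ^ q| ≤ a ^ (q - 1) * |h| := by
  have e1 : |a + h| = a * |1 + h / a| := by
    rw [← abs_of_pos ha, ← abs_mul, abs_of_pos ha]
    congr 1
    field_simp
  have e2 : |(|1 + h / a|) ^ q - 1| ≤ |h| / a := by
    calc _ ≤ |(|1 + h / a|) - 1| := abs_rpow_sub_one_le_abs_sub_one (abs_nonneg _) hq0 hq1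
      _ ≤ |1 + h / a - 1| := by simpa using abs_abs_sub_abs_le_abs_sub (1 + h / a) 1
      _ = |h| / a := by rw [add_sub_cancel_left, abs_div, abs_of_pos ha]
  rw [e1, Real.mul_rpow ha.le (abs_nonneg _), ← mul_sub_one, abs_mul,
    abs_of_pos (Real.rpow_pos_of_pos ha q), Real.rpow_sub_one ha.ne']
  calc _ ≤ a ^ q * (|h| / a) := by gcongr
    _ = a ^ q / a * |h| := by ring

theorem Real.inv_cosh_le_two_mul_exp_neg_abs (y : ℝ) : (Real.cosh y)⁻¹ ≤ 2 * Real.exp (-|y|) := by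
  have h : Real.exp |y| / 2 ≤ Real.cosh y := by
    rw [← Real.cosh_abs, Real.cosh_eq]
    linarith [Real.exp_pos (-|y|)]
  calc (Real.cosh y)⁻¹ ≤ (Real.exp |y| / 2)⁻¹ := inv_anti₀ (by positivity) h
    _ = 2 * Real.exp (-|y|) := by rw [Real.exp_neg, inv_div, div_eq_mul_inv]

theorem Real.hasDerivAt_tanh_mul (b x : ℝ) :
    HasDerivAt (fun x => Real.tanh (b * x)) (b * (1 - Real.tanh (b * x) ^ 2)) x := by
  have hb : HasDerivAt (fun x : ℝ => b * x) b x := by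
    simpa using (hasDerivAt_id x).const_mul b
  have hc : Real.cosh (b * x) ≠ 0 := (Real.cosh_pos _).ne'
  have h := hb.sinh.div hb.cosh hc
  have e : (fun x => Real.tanh (b * x)) = fun x => Real.sinh (b * x) / Real.cosh (b * x) := by
    funext y
    exact Real.tanh_eq_sinh_div_cosh _
  rw [e, Real.tanh_eq_sinh_div_cosh]
  refine h.congr_deriv ?_
  field_simp

theorem solitonQ_pos {p : ℝ} (hp : 1 < p) (x : ℝ) : 0 < solitonQ p x := by
  have := Real.cosh_pos ((p - 1) / 2 * x)
  unfold solitonQ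
  positivity

theorem hasDerivAt_solitonQ {p : ℝ} (hp : 1 < p) (x : ℝ) :
    HasDerivAt (solitonQ p) (-(Real.tanh ((p - 1) / 2 * x)) * solitonQ p x) x := by
  have hb : HasDerivAt (fun x : ℝ => (p - 1) / 2 * x) ((p - 1) / 2) x := by
    simpa using (hasDerivAt_id x).const_mul ((p - 1) / 2)
  have hc := Real.cosh_pos ((p - 1) / 2 * x)
  have hp' : p - 1 ≠ 0 := by linarith
  have h := ((hb.cosh.inv hc.ne').rpow_const (p := 2 / (p - 1))
    (Or.inl (inv_pos.2 hc).ne')).const_mul (((p + 1) / 2) ^ (1 / (p - 1)))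
  refine h.congr_deriv ?_
  simp only [Pi.inv_apply]
  rw [solitonQ, Real.tanh_eq_sinh_div_cosh, Real.rpow_sub_one (inv_pos.2 hc).ne']
  field_simp

theorem hasDerivAt_solitonQ_rpow {p : ℝ} (hp : 1 < p) (k x : ℝ) :
    HasDerivAt (fun x => solitonQ p x ^ k)
      (-k * Real.tanh ((p - 1) / 2 * x) * solitonQ p x ^ k) x := by
  have hQ := solitonQ_pos hp x
  refine ((hasDerivAt_solitonQ hp x).rpow_const (p := k) (Or.inl hQ.ne')).congr_deriv ?_
  rw [Real.rpow_sub_one hQ.ne']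
  field_simp

theorem Sstar_solitonQ_rpow {p : ℝ} (hp : 1 < p) (j k : ℝ) :
    Sstar p j (fun x => solitonQ p x ^ k) =
      fun x => (k - j) * (Real.tanh ((p - 1) / 2 * x) * solitonQ p x ^ k) := by
  funext x
  rw [Sstar, (hasDerivAt_solitonQ_rpow hp k x).deriv]
  ring

theorem phi2_eq {p : ℝ} (hp : 1 < p) (x : ℝ) :
    phi2 p x = ((p - 1) / 2) ^ 2 * (1 + Real.tanh ((p - 1) / 2 * x) ^ 2) *
      solitonQ p x ^ ((3 - p) / 2) := by
  have h : HasDerivAt (fun x => ((3 - p) / 2 - 1) *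
      (Real.tanh ((p - 1) / 2 * x) * solitonQ p x ^ ((3 - p) / 2))) _ x :=
    ((Real.hasDerivAt_tanh_mul ((p - 1) / 2) x).mul
      (hasDerivAt_solitonQ_rpow hp ((3 - p) / 2) x)).const_mul ((3 - p) / 2 - 1)
  rw [phi2, Sstar_solitonQ_rpow hp, Sstar, h.deriv]
  ring

theorem abs_phi2_le {p : ℝ} (hp : 1 < p) (x : ℝ) :
    |phi2 p x| ≤ 2 * ((p - 1) / 2) ^ 2 * solitonQ p x ^ ((3 - p) / 2) := by
  have hQ := Real.rpow_pos_of_pos (solitonQ_pos hp x) ((3 - p) / 2)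
  have hT : Real.tanh ((p - 1) / 2 * x) ^ 2 ≤ 1 := by
    rw [sq_le_one_iff_abs_le_one]
    exact (Real.abs_tanh_lt_one _).le
  rw [phi2_eq hp, abs_of_nonneg (by positivity), mul_comm 2]
  gcongr
  linarith

theorem solitonQ_rpow_half {p : ℝ} (hp : 1 < p) (x : ℝ) :
    solitonQ p x ^ ((p - 1) / 2) =
      ((p + 1) / 2) ^ (1 / 2 : ℝ) * (Real.cosh ((p - 1) / 2 * x))⁻¹ := by
  have hc := Real.cosh_pos ((p - 1) / 2 * x)
  have hp' : p - 1 ≠ 0 := by linarith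
  rw [solitonQ, Real.mul_rpow (by positivity) (by positivity), ← Real.rpow_mul (by positivity),
    ← Real.rpow_mul (by positivity)]
  have e1 : 1 / (p - 1) * ((p - 1) / 2) = 1 / 2 := by field_simp
  have e2 : 2 / (p - 1) * ((p - 1) / 2) = 1 := by field_simp
  rw [e1, e2, Real.rpow_one]

theorem stmt12 (p : ℝ) (hp1 : 5 / 3 < p) (hp2 : p ≤ 2) :
    ∃ δ₀ > (0 : ℝ), ∃ C > (0 : ℝ), ∀ α β : ℝ, |α| + |β| ≤ δ₀ → ∀ x : ℝ,
      |p * |solitonQ p x + α * phi0 p x + β * phi2 p x| ^ (p - 1)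
          - p * solitonQ p x ^ (p - 1)|
        ≤ C * (|α| + |β|) * Real.exp (-((p - 1) / 2) * |x|) := by
  have hp : 1 < p := by linarith
  set M : ℝ := ((p + 1) / 2) ^ (1 / 2 : ℝ) with hM
  have hM0 : 0 < M := by positivity
  set K : ℝ := M ^ 2 + 2 * ((p - 1) / 2) ^ 2 with hK
  have hK0 : 0 < K := by positivity
  refine ⟨1, one_pos, p * (K * (M * 2)), by positivity, fun α β _ x => ?_⟩
  have hQ := solitonQ_pos hp x
  have hu := solitonQ_rpow_half hp x
  rw [← hM] at hu
  set Q := solitonQ p x with hQdef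
  have huM : Q ^ ((p - 1) / 2) ≤ M := by
    rw [hu]
    exact mul_le_of_le_one_right hM0.le (inv_le_one_of_one_le₀ (Real.one_le_cosh _))
  have hue : Q ^ ((p - 1) / 2) ≤ M * (2 * Real.exp (-((p - 1) / 2) * |x|)) := by
    rw [hu]
    have := Real.inv_cosh_le_two_mul_exp_neg_abs ((p - 1) / 2 * x)
    rw [abs_mul, abs_of_pos (by linarith : 0 < (p - 1) / 2), ← neg_mul] at this
    gcongr
  have h0 : Q ^ (p - 1 - 1) * |phi0 p x| ≤ M ^ 2 * Q ^ ((p - 1) / 2) := by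
    rw [phi0, ← hQdef, abs_of_pos (by positivity), ← Real.rpow_add hQ]
    calc Q ^ (p - 1 - 1 + (p + 1) / 2) = Q ^ ((p - 1) / 2 * (3 : ℕ)) := by
          congr 1
          push_cast
          ring
      _ = (Q ^ ((p - 1) / 2)) ^ 2 * Q ^ ((p - 1) / 2) := by
          rw [Real.rpow_mul_natCast hQ.le]
          ring
      _ ≤ _ := by gcongr
  have h2 : Q ^ (p - 1 - 1) * |phi2 p x| ≤ 2 * ((p - 1) / 2) ^ 2 * Q ^ ((p - 1) / 2) := by
    calc _ ≤ Q ^ (p - 1 - 1) * (2 * ((p - 1) / 2) ^ 2 * Q ^ ((3 - p) / 2)) := by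
          gcongr
          exact abs_phi2_le hp x
      _ = 2 * ((p - 1) / 2) ^ 2 * (Q ^ (p - 1 - 1) * Q ^ ((3 - p) / 2)) := by ring
      _ = _ := by
          rw [← Real.rpow_add hQ]
          congr 2
          ring
  rw [← mul_sub, abs_mul, abs_of_pos (by linarith : 0 < p), add_assoc]
  calc _ ≤ p * (Q ^ (p - 1 - 1) * |α * phi0 p x + β * phi2 p x|) := by
        gcongr
        exact abs_abs_add_rpow_sub_rpow_le hQ (by linarith) (by linarith)
    _ ≤ p * (Q ^ (p - 1 - 1) * (|α| * |phi0 p x| + |β| * |phi2 p x|)) := by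
        gcongr
        rw [← abs_mul, ← abs_mul]
        exact abs_add_le _ _
    _ = p * (|α| * (Q ^ (p - 1 - 1) * |phi0 p x|) + |β| * (Q ^ (p - 1 - 1) * |phi2 p x|)) := by
        ring
    _ ≤ p * (|α| * (K * Q ^ ((p - 1) / 2)) + |β| * (K * Q ^ ((p - 1) / 2))) := by
        gcongr p * (|α| * ?_ + |β| * ?_)
        · refine h0.trans ?_
          gcongr
          rw [hK]
          linarith [sq_nonneg ((p - 1) / 2)]
        · refine h2.trans ?_
          gcongr
          rw [hK]
          linarith [sq_nonneg M]
    _ = p * K * (|α| + |β|) * Q ^ ((p - 1) / 2) := by ring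
    _ ≤ p * K * (|α| + |β|) * (M * (2 * Real.exp (-((p - 1) / 2) * |x|))) := by gcongr
    _ = _ := by ring
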